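/- arXiv:1604.03594 — 2 statements merged into one kernel-verified Lean document; each statement's English description precedes it below -/
import Mathlib

section
/- Let R be a factorial domain, f ∈ Int(R) nonzero, and u ∈ 𝒜([[f]]) ∩ R a constant atom of [[f]]. Then the principal ideal u[[f]] is a radical ideal of [[f]]: for all g ∈ [[f]] and n ∈ ℕ, if u ∣ g^n in [[f]] then u ∣ g in [[f]]. -/
open Pointwise Polynomial

namespace IVP

/-! ### Generic monoid-theoretic notions -/

section Generic

variable {M : Type*} [CommMonoid M]

/-- `u` is a unit of the (sub)monoid given by the subset `S`. -/
def IsMUnit (S : Set M) (u : M) : Prop := u ∈ S ∧ ∃ v ∈ S, u * v = 1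

/-- divisibility within the (sub)monoid given by the subset `S`. -/
def MDvd (S : Set M) (x y : M) : Prop := ∃ c ∈ S, y = x * c

/-- `x` and `y` are associated in the (sub)monoid given by the subset `S`. -/
def MAssoc (S : Set M) (x y : M) : Prop := ∃ ε, IsMUnit S ε ∧ y = x * ε

/-- `u` is an atom (irreducible element) of the (sub)monoid given by `S`. -/
def IsMAtom (S : Set M) (u : M) : Prop :=
  u ∈ S ∧ ¬ IsMUnit S u ∧ ∀ x ∈ S, ∀ y ∈ S, u = x * y → IsMUnit S x ∨ IsMUnit S y

/-- `p` is a prime element of the (sub)monoid given by `S`. -/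
def IsMPrime (S : Set M) (p : M) : Prop :=
  p ∈ S ∧ ¬ IsMUnit S p ∧ ∀ a ∈ S, ∀ b ∈ S, MDvd S p (a * b) → MDvd S p a ∨ MDvd S p b

/-- `I` is an `s`-ideal of the (sub)monoid given by `S`. -/
def IsSIdeal (S I : Set M) : Prop := I ⊆ S ∧ ∀ a ∈ I, ∀ h ∈ S, a * h ∈ I

/-- `I` is a prime `s`-ideal of the (sub)monoid given by `S`. -/
def IsPrimeSIdeal (S I : Set M) : Prop :=
  IsSIdeal S I ∧ ∀ a ∈ S, ∀ b ∈ S, a * b ∈ I → a ∈ I ∨ b ∈ I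

/-- `I` is a height-one prime `s`-ideal (a minimal nonempty prime `s`-ideal) of `S`. -/
def IsHeightOnePrime (S I : Set M) : Prop :=
  IsPrimeSIdeal S I ∧ I.Nonempty ∧
    ∀ J : Set M, IsPrimeSIdeal S J → J.Nonempty → J ⊆ I → J = I

/-- `T` is a divisor-closed submonoid of the (sub)monoid given by `S`. -/
def IsDivisorClosed (S T : Set M) : Prop :=
  T ⊆ S ∧ 1 ∈ T ∧ (∀ x ∈ T, ∀ y ∈ T, x * y ∈ T) ∧ ∀ x ∈ S, ∀ y ∈ S, x * y ∈ T → x ∈ T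

/-- the (sub)monoid given by `S` is factorial: every non-unit is a product of primes. -/
def IsFactorialSet (S : Set M) : Prop :=
  ∀ x ∈ S, ¬ IsMUnit S x → ∃ l : List M, (∀ p ∈ l, IsMPrime S p) ∧ x = l.prod

/-- `X⁻¹ = {z ∣ z X ⊆ S}`, computed in an ambient monoid containing the quotients. -/
def setInv (S X : Set M) : Set M := {z | ∀ x ∈ X, z * x ∈ S}

/-- the divisorial closure `X_v = (X⁻¹)⁻¹` relative to the (sub)monoid given by `S`. -/
def vcl (S X : Set M) : Set M := setInv S (setInv S X)

/-- `I` is a divisorial ideal (`v`-ideal) of the (sub)monoid given by `S`. -/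
def IsVIdeal (S I : Set M) : Prop := I ⊆ S ∧ vcl S I = I

/-- `I` is a principal (`s`-)ideal of the (sub)monoid given by `S`. -/
def IsPrincipalIdl (S I : Set M) : Prop := ∃ a ∈ S, I = {a} * S

/-- the `P`-adic exponent of an ideal `I`, via `v_P(I) ≥ n ↔ I ⊆ (Pⁿ)_v`. -/
noncomputable def vexp (S P I : Set M) : ℕ := sSup {n : ℕ | I ⊆ vcl S (P ^ n)}

/-- the exponent of `g` in `y`, i.e. `sup {n ∣ gⁿ ∣ y}`. -/
noncomputable def expOf (g y : M) : ℕ := sSup {n : ℕ | g ^ n ∣ y}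

/-- two ideals lie in the same divisor class iff they differ by a principal factor. -/
def IdlRel (S : Set M) (P Q : Set M) : Prop := ∃ a ∈ S, ∃ b ∈ S, {b} * P = {a} * Q

theorem subset_vcl (S X : Set M) : X ⊆ vcl S X := by
  intro x hx z hz
  rw [mul_comm]
  exact hz x hx

theorem setInv_anti {S X Y : Set M} (h : X ⊆ Y) : setInv S Y ⊆ setInv S X :=
  fun z hz x hx => hz x (h hx)

theorem vcl_mono {S X Y : Set M} (h : X ⊆ Y) : vcl S X ⊆ vcl S Y :=
  setInv_anti (setInv_anti h)

theorem setInv_vcl (S X : Set M) : setInv S (vcl S X) = setInv S X := by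
  apply Set.Subset.antisymm (setInv_anti (subset_vcl S X))
  intro z hz y hy
  rw [mul_comm]
  exact hy z hz

theorem vcl_idem (S X : Set M) : vcl S (vcl S X) = vcl S X := by
  calc vcl S (vcl S X) = setInv S (setInv S (vcl S X)) := rfl
    _ = setInv S (setInv S X) := by rw [setInv_vcl]
    _ = vcl S X := rfl

theorem hstab_vcl {S X : Set M} (hS : ∀ a ∈ S, ∀ b ∈ S, a * b ∈ S) :
    ∀ z ∈ vcl S X, ∀ h ∈ S, z * h ∈ vcl S X := by
  intro z hz h hh w hw
  have h1 : z * w ∈ S := hz w hw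
  have e : z * h * w = z * w * h := mul_right_comm z h w
  rw [e]
  exact hS _ h1 _ hh

theorem bound_vcl {S X : Set M} {c : M} (hc : ∀ x ∈ X, c * x ∈ S) :
    ∀ y ∈ vcl S X, c * y ∈ S := by
  intro y hy
  rw [mul_comm]
  exact hy c hc

theorem mul_subset_vcl_mul (S X Y : Set M) : vcl S X * Y ⊆ vcl S (X * Y) := by
  rintro _ ⟨a, ha, b, hb, rfl⟩ z hz
  have hzb : ∀ x ∈ X, (z * b) * x ∈ S := by
    intro x hx
    have hxb : x * b ∈ X * Y := Set.mul_mem_mul hx hb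
    have h1 := hz _ hxb
    have e : z * b * x = z * (x * b) := by
      rw [mul_assoc, mul_comm b x]
    rw [e]
    exact h1
  have h2 : a * (z * b) ∈ S := ha _ hzb
  have e2 : a * b * z = a * (z * b) := by
    rw [mul_assoc, mul_comm b z]
  rw [e2]
  exact h2

theorem vcl_mul_vcl_left (S X Y : Set M) : vcl S (vcl S X * Y) = vcl S (X * Y) := by
  apply Set.Subset.antisymm
  · have h1 := vcl_mono (S := S) (mul_subset_vcl_mul S X Y)
    rwa [vcl_idem] at h1
  · exact vcl_mono (Set.mul_subset_mul (subset_vcl S X) subset_rfl)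

theorem vcl_mul_vcl_right (S X Y : Set M) : vcl S (X * vcl S Y) = vcl S (X * Y) := by
  rw [mul_comm X, vcl_mul_vcl_left, mul_comm]

theorem coe_mul_self (H : Submonoid M) : (H : Set M) * (H : Set M) = (H : Set M) := by
  apply Set.Subset.antisymm
  · rintro _ ⟨a, ha, b, hb, rfl⟩
    exact mul_mem ha hb
  · intro x hx
    exact ⟨x, hx, 1, H.one_mem, mul_one x⟩

theorem setInv_coe (H : Submonoid M) : setInv (H : Set M) (H : Set M) = (H : Set M) := by
  apply Set.Subset.antisymm
  · intro z hz
    have h1 := hz 1 H.one_mem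
    rwa [mul_one] at h1
  · intro h hh x hx
    exact mul_mem hh hx

theorem vcl_coe (H : Submonoid M) : vcl (H : Set M) (H : Set M) = (H : Set M) := by
  unfold vcl
  rw [setInv_coe, setInv_coe]

theorem coe_mul_eq (H : Submonoid M) {I : Set M} (hI : vcl (H : Set M) I = I) :
    (H : Set M) * I = I := by
  apply Set.Subset.antisymm
  · rintro _ ⟨h, hh, y, hy, rfl⟩
    show h * y ∈ I
    rw [mul_comm]
    rw [← hI] at hy ⊢
    exact hstab_vcl (fun a ha b hb => mul_mem ha hb) y hy h hh
  · intro x hx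
    exact ⟨1, H.one_mem, x, hx, one_mul x⟩

/-- the setoid identifying height-one primes lying in the same divisor class. -/
def primeSetoid (H : Submonoid M) : Setoid {P : Set M // IsHeightOnePrime (H : Set M) P} where
  r P Q := IdlRel (H : Set M) P.1 Q.1
  iseqv := by
    constructor
    · exact fun P => ⟨1, H.one_mem, 1, H.one_mem, rfl⟩
    · rintro P Q ⟨a, ha, b, hb, h⟩
      exact ⟨b, hb, a, ha, h.symm⟩
    · rintro P Q S ⟨a, ha, b, hb, h1⟩ ⟨a', ha', b', hb', h2⟩
      refine ⟨a * a', mul_mem ha ha', b' * b, mul_mem hb' hb, ?_⟩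
      calc ({b' * b} : Set M) * P.1 = {b'} * ({b} * P.1) := by
            rw [← mul_assoc, Set.singleton_mul_singleton]
        _ = {b'} * ({a} * Q.1) := by rw [h1]
        _ = {a} * ({b'} * Q.1) := by
            rw [← mul_assoc, mul_comm ({b'} : Set M) ({a} : Set M), mul_assoc]
        _ = {a} * ({a'} * S.1) := by rw [h2]
        _ = {a * a'} * S.1 := by rw [← mul_assoc, Set.singleton_mul_singleton]

end Generic

/-! ### Krull monoids -/

section Krull

variable {G : Type*} [CommGroup G]

/-- `H` is completely integrally closed (in its quotient group). -/
def IsCIC (H : Submonoid G) : Prop :=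
  ∀ x : G, (∃ c ∈ H, ∀ n : ℕ, c * x ^ n ∈ H) → x ∈ H

/-- `H` is a Mori monoid: the ascending chain condition on divisorial ideals holds. -/
def IsMori (H : Submonoid G) : Prop :=
  ∀ I : ℕ → Set G, (∀ n, (I n).Nonempty ∧ IsVIdeal (H : Set G) (I n)) →
    (∀ n, I n ⊆ I (n + 1)) → ∃ N, ∀ m, N ≤ m → I m = I N

/-- `H` is a Krull monoid, i.e. a completely integrally closed Mori monoid. -/
def IsKrullMonoid (H : Submonoid G) : Prop := IsCIC H ∧ IsMori H

/-- `H ⊆ T` is a saturated submonoid. -/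
def IsSaturated (H T : Submonoid G) : Prop :=
  ∀ x ∈ H, ∀ y ∈ H, (∃ t ∈ T, y = x * t) → ∃ h ∈ H, y = x * h

end Krull

/-! ### The divisor-class group of a submonoid of (the multiplicative monoid of) a field -/

section ClassGrp

variable {F : Type*} [Field F]

/-- `I` is a fractional divisorial ideal of `H`. -/
def IsFracVIdl (H : Submonoid F) (I : Set F) : Prop :=
  I.Nonempty ∧ (∃ a : F, a ≠ 0 ∧ ∀ x ∈ I, a * x ∈ H) ∧ vcl (H : Set F) I = I

/-- the type of fractional divisorial ideals of `H`. -/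
def FIdl (H : Submonoid F) : Type _ := {I : Set F // IsFracVIdl H I}

theorem isFracVIdl_coe (H : Submonoid F) : IsFracVIdl H (H : Set F) :=
  ⟨⟨1, H.one_mem⟩, ⟨1, one_ne_zero, fun x hx => by rwa [one_mul]⟩, vcl_coe H⟩

theorem isFracVIdl_mul {H : Submonoid F} {I J : Set F}
    (hI : IsFracVIdl H I) (hJ : IsFracVIdl H J) :
    IsFracVIdl H (vcl (H : Set F) (I * J)) := by
  obtain ⟨hne, ⟨a, ha0, ha⟩, hIv⟩ := hI
  obtain ⟨hne', ⟨b, hb0, hb⟩, hJv⟩ := hJ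
  refine ⟨(hne.mul hne').mono (subset_vcl _ _), ⟨a * b, mul_ne_zero ha0 hb0, ?_⟩,
    vcl_idem _ _⟩
  intro x hx
  refine bound_vcl ?_ x hx
  rintro _ ⟨u, hu, v, hv, rfl⟩
  have e : a * b * (u * v) = (a * u) * (b * v) := by ring
  rw [e]
  exact mul_mem (ha u hu) (hb v hv)

instance (H : Submonoid F) : CommMonoid (FIdl H) where
  mul I J := ⟨vcl (H : Set F) (I.1 * J.1), isFracVIdl_mul I.2 J.2⟩
  one := ⟨(H : Set F), isFracVIdl_coe H⟩
  mul_assoc I J K := by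
    apply Subtype.ext
    show vcl _ (vcl _ (I.1 * J.1) * K.1) = vcl _ (I.1 * vcl _ (J.1 * K.1))
    rw [vcl_mul_vcl_left, vcl_mul_vcl_right, mul_assoc]
  one_mul I := by
    apply Subtype.ext
    show vcl _ ((H : Set F) * I.1) = I.1
    rw [coe_mul_eq H I.2.2.2, I.2.2.2]
  mul_one I := by
    apply Subtype.ext
    show vcl _ (I.1 * (H : Set F)) = I.1
    rw [mul_comm, coe_mul_eq H I.2.2.2, I.2.2.2]
  mul_comm I J := by
    apply Subtype.ext
    show vcl _ (I.1 * J.1) = vcl _ (J.1 * I.1)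
    rw [mul_comm]

theorem setInv_prin (H : Submonoid F) {a : F} (ha : a ≠ 0) :
    setInv (H : Set F) ({a} * (H : Set F)) = {a⁻¹} * (H : Set F) := by
  apply Set.Subset.antisymm
  · intro z hz
    have h1 : z * (a * 1) ∈ H := hz _ (Set.mul_mem_mul rfl H.one_mem)
    rw [mul_one] at h1
    refine ⟨a⁻¹, rfl, z * a, h1, ?_⟩
    show a⁻¹ * (z * a) = z
    rw [mul_comm z a, ← mul_assoc, inv_mul_cancel₀ ha, one_mul]
  · rintro _ ⟨s, hs, h, hh, rfl⟩ _ ⟨t, ht, k, hk, rfl⟩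
    rw [Set.mem_singleton_iff] at hs ht
    rw [hs, ht]
    have e : a⁻¹ * h * (a * k) = (a⁻¹ * a) * (h * k) := by ring
    rw [e, inv_mul_cancel₀ ha, one_mul]
    exact mul_mem hh hk

theorem isFracVIdl_prin (H : Submonoid F) {a : F} (ha : a ≠ 0) :
    IsFracVIdl H ({a} * (H : Set F)) := by
  refine ⟨⟨a * 1, Set.mul_mem_mul rfl H.one_mem⟩, ⟨a⁻¹, inv_ne_zero ha, ?_⟩, ?_⟩
  · rintro _ ⟨s, hs, h, hh, rfl⟩
    rw [Set.mem_singleton_iff] at hs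
    rw [hs]
    have e : a⁻¹ * (a * h) = (a⁻¹ * a) * h := by ring
    rw [e, inv_mul_cancel₀ ha, one_mul]
    exact hh
  · unfold vcl
    rw [setInv_prin H ha, setInv_prin H (inv_ne_zero ha), inv_inv]

theorem prin_mul_set (H : Submonoid F) (a b : F) :
    ({a} * (H : Set F)) * ({b} * (H : Set F)) = {a * b} * (H : Set F) := by
  rw [mul_mul_mul_comm, Set.singleton_mul_singleton, coe_mul_self]

/-- the homomorphism sending `a` to the principal fractional ideal `aH`. -/
def prinHom (H : Submonoid F) : Fˣ →* (FIdl H)ˣ where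
  toFun a :=
    { val := ⟨{(a : F)} * (H : Set F), isFracVIdl_prin H a.ne_zero⟩
      inv := ⟨{((a⁻¹ : Fˣ) : F)} * (H : Set F), isFracVIdl_prin H a⁻¹.ne_zero⟩
      val_inv := by
        apply Subtype.ext
        show vcl (H : Set F) (({(a : F)} * (H : Set F)) * ({((a⁻¹ : Fˣ) : F)} * (H : Set F)))
          = (H : Set F)
        rw [prin_mul_set, Units.mul_inv, Set.singleton_one, one_mul, vcl_coe]
      inv_val := by
        apply Subtype.ext
        show vcl (H : Set F) (({((a⁻¹ : Fˣ) : F)} * (H : Set F)) * ({(a : F)} * (H : Set F)))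
          = (H : Set F)
        rw [prin_mul_set, Units.inv_mul, Set.singleton_one, one_mul, vcl_coe] }
  map_one' := by
    apply Units.ext
    apply Subtype.ext
    show ({((1 : Fˣ) : F)} : Set F) * (H : Set F) = (H : Set F)
    rw [Units.val_one, Set.singleton_one, one_mul]
  map_mul' a b := by
    apply Units.ext
    apply Subtype.ext
    show ({((a * b : Fˣ) : F)} : Set F) * (H : Set F)
      = vcl (H : Set F) (({(a : F)} * (H : Set F)) * ({(b : F)} * (H : Set F)))
    rw [prin_mul_set, Units.val_mul,
      (isFracVIdl_prin H (mul_ne_zero a.ne_zero b.ne_zero)).2.2]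

/-- the divisor-class group: `v`-invertible fractional `v`-ideals modulo principal ones. -/
def ClassGrp (H : Submonoid F) : Type _ := (FIdl H)ˣ ⧸ (prinHom H).range

instance (H : Submonoid F) : CommGroup (ClassGrp H) :=
  inferInstanceAs (CommGroup ((FIdl H)ˣ ⧸ (prinHom H).range))

end ClassGrp

/-! ### Integer-valued polynomials over a factorial domain -/

section IntR

variable (R : Type*) [CommRing R] [IsDomain R] [UniqueFactorizationMonoid R]

/-- the quotient field of `R`. -/
abbrev Kq := FractionRing R

/-- the polynomial ring `K[X]` over the quotient field of `R`. -/
abbrev PK := Polynomial (Kq R)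

/-- the field of rational functions, containing the quotient group of `Int(R)•`. -/
abbrev FF := FractionRing (PK R)

/-- the constant polynomial given by `r : R`. -/
noncomputable def cpoly (r : R) : PK R := Polynomial.C (algebraMap R (Kq R) r)

/-- the set of integer-valued polynomials: `g ∈ K[X]` with `g(R) ⊆ R`. -/
def intSet : Set (PK R) :=
  {g | ∀ x : R, ∃ r : R, Polynomial.eval (algebraMap R (Kq R) x) g = algebraMap R (Kq R) r}

/-- the monadic submonoid `[[f]]` of `Int(R)•` generated by `f`. -/
def mon (f : PK R) : Set (PK R) :=
  {g | g ∈ intSet R ∧ g ≠ 0 ∧ ∃ k : ℕ, ∃ h ∈ intSet R, g * h = f ^ k}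

/-- the subring `R[X]`: polynomials all of whose coefficients lie in `R`. -/
def rxSet : Set (PK R) :=
  {g | ∀ n : ℕ, ∃ r : R, g.coeff n = algebraMap R (Kq R) r}

/-- the multiplicative monoid `R[X]•`. -/
def rxnz : Set (PK R) := {g | g ∈ rxSet R ∧ g ≠ 0}

/-- the multiplicative monoid `Int(R)•`. -/
def intnz : Set (PK R) := {g | g ∈ intSet R ∧ g ≠ 0}

/-- `g` is a primitive polynomial in `R[X]`: every common divisor of its coefficients
is a unit of `R`. -/
def IsPrimPoly (g : PK R) : Prop :=
  ∀ r : R, (∀ n : ℕ, ∃ s : R, g.coeff n = algebraMap R (Kq R) (r * s)) → IsUnit r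

/-- `d` is an image-content function: `d g` is a greatest common divisor (in `R`)
of the image `g(R)`. -/
def IsImageGcdFun (d : PK R → R) : Prop :=
  ∀ g ∈ intSet R, g ≠ 0 →
    (∀ x : R, ∃ r : R,
        Polynomial.eval (algebraMap R (Kq R) x) g = algebraMap R (Kq R) (d g * r)) ∧
      ∀ r : R, (∀ x : R, ∃ s : R,
          Polynomial.eval (algebraMap R (Kq R) x) g = algebraMap R (Kq R) (r * s)) →
        r ∣ d g

/-- `e` is a least common multiple in `R` of the set `{d(g·h)/d(h) : h ∈ [[f]]}`,
i.e. `e = e_f(g)` up to associates. -/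
def IsEfVal (d : PK R → R) (f g : PK R) (e : R) : Prop :=
  (∀ h ∈ mon R f, d (g * h) ∣ d h * e) ∧
    ∀ r : R, (∀ h ∈ mon R f, d (g * h) ∣ d h * r) → e ∣ r

theorem intSet_one : (1 : PK R) ∈ intSet R := fun _ => ⟨1, by simp⟩

theorem intSet_mul {g h : PK R} (hg : g ∈ intSet R) (hh : h ∈ intSet R) :
    g * h ∈ intSet R := by
  intro x
  obtain ⟨r, hr⟩ := hg x
  obtain ⟨s, hs⟩ := hh x
  exact ⟨r * s, by rw [Polynomial.eval_mul, hr, hs, map_mul]⟩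

theorem mon_one (f : PK R) : (1 : PK R) ∈ mon R f :=
  ⟨intSet_one R, one_ne_zero, 0, 1, intSet_one R, by simp⟩

theorem mon_mul {f g h : PK R} (hg : g ∈ mon R f) (hh : h ∈ mon R f) :
    g * h ∈ mon R f := by
  obtain ⟨hgI, hg0, k, a, haI, hka⟩ := hg
  obtain ⟨hhI, hh0, l, b, hbI, hlb⟩ := hh
  refine ⟨intSet_mul R hgI hhI, mul_ne_zero hg0 hh0, k + l, a * b, intSet_mul R haI hbI, ?_⟩
  rw [pow_add, ← hka, ← hlb]
  ring

/-- the monadic submonoid `[[f]]`, viewed inside the field of rational functions. -/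
noncomputable def Hmon (f : PK R) : Submonoid (FF R) where
  carrier := algebraMap (PK R) (FF R) '' mon R f
  one_mem' := ⟨1, mon_one R f, map_one _⟩
  mul_mem' := by
    rintro x y ⟨a, ha, rfl⟩ ⟨b, hb, rfl⟩
    exact ⟨a * b, mon_mul R ha hb, map_mul _ _ _⟩

/-- the ideal `gK[X] ∩ [[f]]`, at the level of polynomials. -/
def pIdlP (f g : PK R) : Set (PK R) := {z | z ∈ mon R f ∧ ∃ h : PK R, z = g * h}

/-- the ideal `gK[X] ∩ [[f]]`, inside the field of rational functions. -/
noncomputable def pIdl (f g : PK R) : Set (FF R) := algebraMap (PK R) (FF R) '' pIdlP R f g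

end IntR

end IVP

open IVP Pointwise Polynomial
theorem cpoly_int_aux (R : Type*) [CommRing R] [IsDomain R] [UniqueFactorizationMonoid R]
    (a : R) : cpoly R a ∈ intSet R := fun x => ⟨a, by simp [cpoly]⟩

theorem cpoly_mul_aux (R : Type*) [CommRing R] [IsDomain R] [UniqueFactorizationMonoid R]
    (a b : R) : cpoly R (a * b) = cpoly R a * cpoly R b := by simp [cpoly]

theorem cpoly_unit_aux (R : Type*) [CommRing R] [IsDomain R] [UniqueFactorizationMonoid R]
    (f : PK R) (a : R) (h : IsMUnit (mon R f) (cpoly R a)) : IsUnit a := by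
  obtain ⟨-, w, hw, e⟩ := h
  obtain ⟨r, hr⟩ := hw.1 0
  have e2 := congrArg (Polynomial.eval (algebraMap R (Kq R) 0)) e
  rw [Polynomial.eval_mul, hr, Polynomial.eval_one, cpoly, Polynomial.eval_C, ← map_mul,
    ← map_one (algebraMap R (Kq R))] at e2
  exact IsUnit.of_mul_eq_one r (IsFractionRing.injective R (Kq R) e2)

theorem cpoly_dvd_aux (R : Type*) [CommRing R] [IsDomain R] [UniqueFactorizationMonoid R]
    (f : PK R) (a b : R) (h : cpoly R (a * b) ∈ mon R f) : cpoly R a ∈ mon R f := by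
  obtain ⟨-, h0, k, w, hw, e⟩ := h
  rw [cpoly_mul_aux] at h0 e
  exact ⟨cpoly_int_aux R a, left_ne_zero_of_mul h0, k, cpoly R b * w,
    intSet_mul R (cpoly_int_aux R b) hw, by rw [← e, mul_assoc]⟩

/-- Lemma `general`.3. -/
theorem stmt_2 (R : Type*) [CommRing R] [IsDomain R] [UniqueFactorizationMonoid R]
    (f : PK R) (hf : f ∈ intSet R) (hf0 : f ≠ 0)
    (u : R) (hu : IsMAtom (mon R f) (cpoly R u))
    (g : PK R) (hg : g ∈ mon R f) (n : ℕ) (hn : 0 < n)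
    (hdvd : MDvd (mon R f) (cpoly R u) (g ^ n)) :
    MDvd (mon R f) (cpoly R u) g := by
  have inj := IsFractionRing.injective R (Kq R)
  obtain ⟨hum, hnu, hat⟩ := hu
  have hu0 : u ≠ 0 := by
    rintro rfl
    exact hum.2.1 (by simp [cpoly])
  have hirr : Irreducible u := by
    constructor
    · intro hU
      obtain ⟨v, hv⟩ := hU.exists_right_inv
      have e : cpoly R u * cpoly R v = 1 := by rw [← cpoly_mul_aux, hv]; simp [cpoly]
      refine hnu ⟨hum, cpoly R v, ?_, e⟩
      refine cpoly_dvd_aux R f v u ?_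
      rw [mul_comm, hv]
      have : cpoly R 1 = 1 := by simp [cpoly]
      rw [this]
      exact mon_one R f
    · intro a b hab
      have ha := cpoly_dvd_aux R f a b (hab ▸ hum)
      have hb := cpoly_dvd_aux R f b a (by rw [mul_comm]; exact hab ▸ hum)
      rcases hat _ ha _ hb (by rw [hab, cpoly_mul_aux]) with h | h
      · exact Or.inl (cpoly_unit_aux R f a h)
      · exact Or.inr (cpoly_unit_aux R f b h)
  have hp : Prime u := hirr.prime
  have hk0 : algebraMap R (Kq R) u ≠ 0 := fun h => hu0 (inj (by rw [h, map_zero]))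
  obtain ⟨c, hc, ec⟩ := hdvd
  obtain ⟨hgI, hg0, k, w, hw, ew⟩ := hg
  have eg : g = cpoly R u * (Polynomial.C (algebraMap R (Kq R) u)⁻¹ * g) := by
    rw [cpoly, ← mul_assoc, ← Polynomial.C_mul, mul_inv_cancel₀ hk0, Polynomial.C_1, one_mul]
  refine ⟨Polynomial.C (algebraMap R (Kq R) u)⁻¹ * g, ⟨?_, ?_, k, cpoly R u * w,
    intSet_mul R (cpoly_int_aux R u) hw, ?_⟩, eg⟩
  · intro x
    obtain ⟨r, hr⟩ := hgI x
    obtain ⟨s, hs⟩ := hc.1 x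
    have e2 := congrArg (Polynomial.eval (algebraMap R (Kq R) x)) ec
    rw [Polynomial.eval_mul, hs, Polynomial.eval_pow, hr, cpoly, Polynomial.eval_C, ← map_mul,
      ← map_pow] at e2
    obtain ⟨t, rfl⟩ := hp.dvd_of_dvd_pow (Dvd.intro s (inj e2).symm)
    refine ⟨t, ?_⟩
    rw [Polynomial.eval_mul, Polynomial.eval_C, hr, map_mul, inv_mul_cancel_left₀ hk0]
  · intro h
    rw [h, mul_zero] at eg
    exact hg0 eg
  · rw [← ew]
    conv_rhs => rw [eg]
    ring
end

section
/- Let R be a factorial domain and f ∈ Int(R) nonzero. If P is a height-one prime s-ideal of [[f]] and u, w ∈ P ∩ 𝒜(R), then u and w are associated in [[f]] (i.e., u = εw for some unit ε of [[f]]). In particular, every height-one prime ideal of [[f]] contains at most one constant atom up to associates. -/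
open Pointwise Polynomial

open IVP Pointwise Polynomial

theorem aux_intSet_cpoly (R : Type*) [CommRing R] [IsDomain R] [UniqueFactorizationMonoid R]
    (r : R) : cpoly R r ∈ intSet R := fun x => ⟨r, by simp [cpoly]⟩

theorem aux_unit (R : Type*) [CommRing R] [IsDomain R] [UniqueFactorizationMonoid R]
    (f : PK R) (e : Rˣ) : IsMUnit (mon R f) (cpoly R (e : R)) := by
  have key : ∀ e : Rˣ, cpoly R (e : R) * cpoly R ((e⁻¹ : Rˣ) : R) = 1 := by
    intro e
    simp only [cpoly]
    rw [← Polynomial.C_mul, ← map_mul, Units.mul_inv, map_one, map_one]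
  have mem : ∀ e : Rˣ, cpoly R (e : R) ∈ mon R f := by
    intro e
    refine ⟨aux_intSet_cpoly R _, left_ne_zero_of_mul_eq_one (key e), 0, _,
      aux_intSet_cpoly R ((e⁻¹ : Rˣ) : R), ?_⟩
    rw [key, pow_zero]
  exact ⟨mem e, _, mem e⁻¹, key e⟩

/-- In a height-one prime, every element divides a power of any other one up to a factor
outside of the prime. -/
theorem aux_primary {M : Type*} [CommMonoid M] (S P : Set M) (h1 : (1 : M) ∈ S)
    (hmul : ∀ a ∈ S, ∀ b ∈ S, a * b ∈ S) (hP : IsHeightOnePrime S P) (a b : M)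
    (ha : a ∈ P) (hb : b ∈ P) (hbu : ¬ IsMUnit S b) :
    ∃ n : ℕ, ∃ s ∈ S, s ∉ P ∧ ∃ c ∈ S, b * c = a ^ n * s := by
  obtain ⟨⟨⟨hPS, hid⟩, hpr⟩, hne, hmin⟩ := hP
  have h1P : (1 : M) ∉ P := by
    intro h1P
    have hJ : {z | z ∈ S ∧ ¬ IsMUnit S z} = P := by
      apply hmin
      · refine ⟨⟨fun z hz => hz.1, ?_⟩, ?_⟩
        · rintro z ⟨hz, hz'⟩ h hh
          refine ⟨hmul _ hz _ hh, ?_⟩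
          rintro ⟨_, v, hv, e⟩
          exact hz' ⟨hz, h * v, hmul _ hh _ hv, by rw [← e, mul_assoc]⟩
        · rintro x hx y hy ⟨_, hxy⟩
          by_contra hno
          rw [not_or] at hno
          obtain ⟨hx', hy'⟩ := hno
          obtain ⟨_, v, hv, e⟩ := not_not.1 fun h => hx' ⟨hx, h⟩
          obtain ⟨_, v', hv', e'⟩ := not_not.1 fun h => hy' ⟨hy, h⟩
          exact hxy ⟨hmul _ hx _ hy, v * v', hmul _ hv _ hv', by
            rw [mul_mul_mul_comm, e, e', mul_one]⟩
      · exact ⟨b, hPS hb, hbu⟩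
      · rintro z ⟨hz, _⟩
        simpa using hid 1 h1P z hz
    rw [← hJ] at h1P
    exact h1P.2 ⟨h1, 1, h1, one_mul 1⟩
  by_contra hcon
  let J : Set M := {z | z ∈ S ∧ ¬ ∃ n : ℕ, ∃ s ∈ S, s ∉ P ∧ ∃ c ∈ S, z * c = a ^ n * s}
  have hJ : J = P := by
    apply hmin
    · refine ⟨⟨fun z hz => hz.1, ?_⟩, ?_⟩
      · rintro z ⟨hz, hz'⟩ h hh
        refine ⟨hmul _ hz _ hh, ?_⟩
        rintro ⟨n, s, hs, hsP, c, hc, e⟩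
        exact hz' ⟨n, s, hs, hsP, h * c, hmul _ hh _ hc, by rw [← e, mul_assoc]⟩
      · rintro x hx y hy ⟨_, hxy⟩
        by_contra hno
        rw [not_or] at hno
        obtain ⟨hx', hy'⟩ := hno
        have hx2 := not_not.1 fun h => hx' ⟨hx, h⟩
        have hy2 := not_not.1 fun h => hy' ⟨hy, h⟩
        obtain ⟨n, s, hs, hsP, c, hc, e⟩ := hx2
        obtain ⟨m, t, ht, htP, d, hd, e'⟩ := hy2
        refine hxy ⟨n + m, s * t, hmul _ hs _ ht, ?_, c * d, hmul _ hc _ hd, ?_⟩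
        · intro h
          exact (hpr _ hs _ ht h).elim hsP htP
        · rw [mul_mul_mul_comm, e, e', pow_add, mul_mul_mul_comm]
    · exact ⟨b, hPS hb, hcon⟩
    · rintro z ⟨hz, hz'⟩
      by_contra hzP
      exact hz' ⟨0, z, hz, hzP, 1, h1, by simp⟩
  have : a ∈ J := hJ ▸ ha
  exact this.2 ⟨1, 1, h1, h1P, 1, h1, by simp⟩

/-- Lemma `general`.4. -/
theorem stmt_3 (R : Type*) [CommRing R] [IsDomain R] [UniqueFactorizationMonoid R]
    (f : PK R) (hf : f ∈ intSet R) (hf0 : f ≠ 0)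
    (P : Set (PK R)) (hP : IsHeightOnePrime (mon R f) P)
    (u w : R) (hu : Irreducible u) (hw : Irreducible w)
    (huP : cpoly R u ∈ P) (hwP : cpoly R w ∈ P) :
    MAssoc (mon R f) (cpoly R u) (cpoly R w) := by
  have hinj := IsFractionRing.injective R (Kq R)
  have hwp : Prime w := hw.prime
  have hw0 : algebraMap R (Kq R) w ≠ 0 := by
    intro h
    exact hwp.ne_zero (hinj (by rw [h, map_zero]))
  have hnu : ¬ IsMUnit (mon R f) (cpoly R w) := by
    rintro ⟨_, v, hv, e⟩
    obtain ⟨r, hr⟩ := hv.1 0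
    have e2 := congrArg (Polynomial.eval (algebraMap R (Kq R) 0)) e
    rw [Polynomial.eval_mul, hr, cpoly, Polynomial.eval_C, Polynomial.eval_one, ← map_mul,
      ← map_one (algebraMap R (Kq R))] at e2
    exact hw.not_isUnit (IsUnit.of_mul_eq_one _ (hinj e2))
  obtain ⟨n, s, hs, hsP, c, hc, e⟩ := aux_primary (mon R f) P (mon_one R f)
    (fun a ha b hb => mon_mul R ha hb) hP _ _ huP hwP hnu
  by_cases hwu : w ∣ u
  · obtain ⟨t, ht⟩ := (hwp.irreducible.associated_of_dvd hu hwu).symm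
    refine ⟨cpoly R (t : R), aux_unit R f t, ?_⟩
    rw [← ht]
    simp [cpoly]
  · exfalso
    apply hsP
    set q : PK R := Polynomial.C (algebraMap R (Kq R) w)⁻¹ * s with hq
    have hqs : cpoly R w * q = s := by
      rw [hq, cpoly, ← mul_assoc, ← Polynomial.C_mul, mul_inv_cancel₀ hw0, map_one, one_mul]
    have hqI : q ∈ intSet R := by
      intro x
      obtain ⟨a, ha⟩ := hs.1 x
      obtain ⟨b, hb⟩ := hc.1 x
      have e2 := congrArg (Polynomial.eval (algebraMap R (Kq R) x)) e
      rw [Polynomial.eval_mul, Polynomial.eval_mul, Polynomial.eval_pow, ha, hb, cpoly, cpoly,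
        Polynomial.eval_C, Polynomial.eval_C, ← map_pow, ← map_mul, ← map_mul] at e2
      have e3 : w ∣ u ^ n * a := ⟨b, (hinj e2).symm⟩
      obtain ⟨a', rfl⟩ := (hwp.dvd_or_dvd e3).resolve_left fun h => hwu (hwp.dvd_of_dvd_pow h)
      refine ⟨a', ?_⟩
      rw [hq, Polynomial.eval_mul, ha, Polynomial.eval_C, map_mul, inv_mul_cancel_left₀ hw0]
    have hqm : q ∈ mon R f := by
      obtain ⟨_, hs0, k, h, hh, hk⟩ := hs
      refine ⟨hqI, ?_, k, cpoly R w * h, intSet_mul R (aux_intSet_cpoly R w) hh, ?_⟩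
      · intro h0
        rw [h0, mul_zero] at hqs
        exact hs0 hqs.symm
      · rw [← hk, ← hqs]
        ring
    rw [← hqs]
    exact hP.1.1.2 _ hwP _ hqm
end
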